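/- arXiv:2403.00341 — 4 statements merged into one kernel-verified Lean document; each statement's English description precedes it below -/
import Mathlib

section
/- Let 0 < α < 1, T > 0, and let x : [0,T] → ℂ be twice continuously differentiable. Then for every t ∈ (0,T]: (1/Γ(1−α)) ∫₀ᵗ (t−τ)^{−α} x′(τ) dτ = (1/Γ(2−α)) ( t^{1−α} x′(0) + ∫₀ᵗ (t−τ)^{1−α} x″(τ) dτ ). Equivalently, the L-fractional derivative satisfies (ᴸD^α x)(t) = x′(0) + t^{α−1} ∫₀ᵗ (t−τ)^{1−α} x″(τ) dτ, a representation with the non-singular kernel (t−τ)^{1−α}. -/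
open MeasureTheory Set

/-- For a twice continuously differentiable `x` on `[0,T]`, integration by parts turns the
Caputo derivative into a non-singular-kernel representation; equivalently the L-fractional
derivative satisfies `ᴸD^α x (t) = x′(0) + t^(α-1) ∫₀ᵗ (t-τ)^(1-α) x″(τ) dτ`. -/
theorem caputo_integration_by_parts
    (α T : ℝ) (hα0 : 0 < α) (hα1 : α < 1) (hT : 0 < T)
    (x x' x'' : ℝ → ℂ)
    (hx' : ∀ t ∈ Icc (0:ℝ) T, HasDerivWithinAt x (x' t) (Icc 0 T) t)
    (hx'' : ∀ t ∈ Icc (0:ℝ) T, HasDerivWithinAt x' (x'' t) (Icc 0 T) t)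
    (hcont : ContinuousOn x'' (Icc (0:ℝ) T)) :
    ∀ t ∈ Ioc (0:ℝ) T,
      (((1 / Real.Gamma (1 - α) : ℝ)) : ℂ) *
          ∫ τ in (0:ℝ)..t, (((t - τ) ^ (-α) : ℝ) : ℂ) * x' τ
        = ((1 / Real.Gamma (2 - α) : ℝ) : ℂ) *
            (((t ^ (1 - α) : ℝ) : ℂ) * x' 0 +
              ∫ τ in (0:ℝ)..t, (((t - τ) ^ (1 - α) : ℝ) : ℂ) * x'' τ) ∧
      ((Real.Gamma (2 - α) * t ^ (α - 1) / Real.Gamma (1 - α) : ℝ) : ℂ) *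
          ∫ τ in (0:ℝ)..t, (((t - τ) ^ (-α) : ℝ) : ℂ) * x' τ
        = x' 0 + ((t ^ (α - 1) : ℝ) : ℂ) *
            ∫ τ in (0:ℝ)..t, (((t - τ) ^ (1 - α) : ℝ) : ℂ) * x'' τ := by
  intro t ht
  have ht0 : 0 < t := ht.1
  have h1a : 0 < 1 - α := by linarith
  have hsub : Icc (0:ℝ) t ⊆ Icc 0 T := Icc_subset_Icc_right ht.2
  have hparts := intervalIntegral.integral_mul_deriv_eq_deriv_mul_of_hasDerivAt
    (a := 0) (b := t)
    (u := fun τ : ℝ => (((t - τ) ^ (1 - α) : ℝ) : ℂ))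
    (u' := fun τ : ℝ => (-(1 - α : ℝ) : ℂ) * (((t - τ) ^ (-α) : ℝ) : ℂ))
    (v := x') (v' := x'')
    (by
      apply Continuous.continuousOn
      apply Complex.continuous_ofReal.comp
      exact (continuous_const.sub continuous_id).rpow_const (fun _ => Or.inr h1a.le))
    (by
      rw [uIcc_of_le ht0.le]
      exact fun s hs => ((hx'' s (hsub hs)).continuousWithinAt).mono hsub)
    (by
      intro s hs
      rw [min_eq_left ht0.le, max_eq_right ht0.le] at hs
      have hpos : 0 < t - s := sub_pos.2 hs.2
      have h := (((hasDerivAt_id s).const_sub t).rpow_const (p := 1 - α)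
        (Or.inl (ne_of_gt hpos))).ofReal_comp
      have he : (((-1 * (1 - α) * (t - id s) ^ (1 - α - 1) : ℝ)) : ℂ)
          = (-(1 - α : ℝ) : ℂ) * (((t - s) ^ (-α) : ℝ) : ℂ) := by
        rw [show (1 - α - 1 : ℝ) = -α by ring]
        simp
      rw [he] at h
      exact h)
    (by
      intro s hs
      rw [min_eq_left ht0.le, max_eq_right ht0.le] at hs
      exact (hx'' s ⟨hs.1.le, hs.2.le.trans ht.2⟩).hasDerivAt
        (Icc_mem_nhds hs.1 (hs.2.trans_le ht.2)))
    (by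
      apply IntervalIntegrable.const_mul
      have h := (intervalIntegral.intervalIntegrable_rpow' (a := t) (b := 0) (r := -α)
        (by linarith)).comp_sub_left t
      simp only [sub_self, sub_zero] at h
      exact ⟨h.1.ofReal, h.2.ofReal⟩)
    (by
      apply ContinuousOn.intervalIntegrable
      rw [uIcc_of_le ht0.le]
      exact hcont.mono hsub)
  have hG : Real.Gamma (2 - α) = (1 - α) * Real.Gamma (1 - α) := by
    rw [show (2 - α : ℝ) = (1 - α) + 1 by ring, Real.Gamma_add_one h1a.ne']
  have hG0 : (Real.Gamma (1 - α) : ℂ) ≠ 0 := by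
    exact_mod_cast (Real.Gamma_pos_of_pos h1a).ne'
  have h1c : (1 - α : ℂ) ≠ 0 := by exact_mod_cast h1a.ne'
  have htt : ((t ^ (α - 1) : ℝ) : ℂ) * ((t ^ (1 - α) : ℝ) : ℂ) = 1 := by
    rw [← Complex.ofReal_mul, ← Real.rpow_add ht0]
    simp
  simp only [mul_assoc, intervalIntegral.integral_const_mul, sub_self, sub_zero,
    Real.zero_rpow h1a.ne', Complex.ofReal_zero, zero_mul, zero_sub] at hparts
  rw [hparts, hG]
  generalize (∫ τ in (0:ℝ)..t, (((t - τ) ^ (-α) : ℝ) : ℂ) * x' τ) = I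
  generalize t ^ (α - 1) = p at *
  generalize t ^ (1 - α) = q at *
  push_cast
  constructor
  · field_simp
    ring
  · field_simp
    linear_combination x' 0 * htt
end

section
/- Let 0 < α ≤ 1/2 and T > 0. Then the two operators ᴸJ^α ∘ ᴸJ^α and ᴸJ^{2α} on continuous functions do not coincide: there exist a continuous function y : [0,T] → ℂ and a point t ∈ [0,T] such that (ᴸJ^α (ᴸJ^α y))(t) ≠ (ᴸJ^{2α} y)(t). -/
open MeasureTheory

/-- The L-fractional integral of order `β` of `y : [0,T] → ℂ`. -/
noncomputable def LJ (β : ℝ) (y : ℝ → ℂ) (t : ℝ) : ℂ :=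
  ((1 / (Real.Gamma β * Real.Gamma (2 - β)) : ℝ) : ℂ) *
    ∫ s in (0:ℝ)..t, (((t - s) ^ (β - 1) * s ^ (1 - β) : ℝ) : ℂ) * y s

lemma LJ_pow (β : ℝ) (h0 : 0 < β) (h1 : β ≤ 1) (n : ℕ) (t : ℝ) (ht : 0 < t) :
    LJ β (fun s => (s : ℂ) ^ n) t =
      ((t ^ (n + 1) * (Real.Gamma (n + 2 - β) / (Real.Gamma (2 - β) * Real.Gamma (n + 2))) : ℝ) : ℂ) := by
  have hn : (0 : ℝ) ≤ n := Nat.cast_nonneg n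
  have hI : (∫ s in (0:ℝ)..t, (((t - s) ^ (β - 1) * s ^ (1 - β) : ℝ) : ℂ) * (s : ℂ) ^ n) =
      ∫ s in (0:ℝ)..t, (s : ℂ) ^ (((n + 2 - β : ℝ) : ℂ) - 1) * ((t : ℂ) - s) ^ ((β : ℂ) - 1) := by
    apply intervalIntegral.integral_congr_ae
    refine Filter.Eventually.of_forall fun s hs => ?_
    rw [Set.uIoc_of_le ht.le] at hs
    have e1 : (s : ℂ) ^ (((n + 2 - β : ℝ) : ℂ) - 1) = ((s ^ (1 - β) * s ^ n : ℝ) : ℂ) := by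
      rw [← Real.rpow_natCast s n, ← Real.rpow_add hs.1, Complex.ofReal_cpow hs.1.le]
      congr 1
      push_cast
      ring
    have e2 : ((t : ℂ) - s) ^ ((β : ℂ) - 1) = (((t - s) ^ (β - 1) : ℝ) : ℂ) := by
      rw [Complex.ofReal_cpow (by linarith [hs.2])]
      push_cast
      rfl
    rw [e1, e2]
    push_cast
    ring
  have hB := Complex.Gamma_mul_Gamma_eq_betaIntegral (s := ((n + 2 - β : ℝ) : ℂ)) (t := (β : ℂ))
    (by rw [Complex.ofReal_re]; linarith) (by rw [Complex.ofReal_re]; exact h0)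
  have g0 : Real.Gamma β ≠ 0 := (Real.Gamma_pos_of_pos h0).ne'
  have g1 : Real.Gamma (2 - β) ≠ 0 := (Real.Gamma_pos_of_pos (by linarith)).ne'
  have g2 : Real.Gamma (n + 2) ≠ 0 := (Real.Gamma_pos_of_pos (by linarith)).ne'
  have es : ((n + 2 - β : ℝ) : ℂ) + (β : ℂ) = ((n + 2 : ℝ) : ℂ) := by push_cast; ring
  have et : (t : ℂ) ^ (((n + 2 : ℝ) : ℂ) - 1) = ((t ^ (n + 1) : ℝ) : ℂ) := by
    rw [← Real.rpow_natCast t (n + 1), Complex.ofReal_cpow ht.le]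
    congr 1
    push_cast
    ring
  rw [es, Complex.Gamma_ofReal, Complex.Gamma_ofReal, Complex.Gamma_ofReal] at hB
  have hB' : Complex.betaIntegral ((n + 2 - β : ℝ) : ℂ) (β : ℂ) =
      ((Real.Gamma (n + 2 - β) * Real.Gamma β / Real.Gamma (n + 2) : ℝ) : ℂ) := by
    have g2' : ((Real.Gamma (n + 2) : ℝ) : ℂ) ≠ 0 := Complex.ofReal_ne_zero.mpr g2
    rw [Complex.ofReal_div, Complex.ofReal_mul, hB]
    field_simp
  unfold LJ
  rw [hI, Complex.betaIntegral_scaled _ _ ht, es, et, hB', ← Complex.ofReal_mul,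
    ← Complex.ofReal_mul]
  congr 1
  field_simp

lemma LJ_one (β : ℝ) (h0 : 0 < β) (h1 : β ≤ 1) (t : ℝ) (ht : 0 < t) :
    LJ β (fun _ => 1) t = (t : ℂ) := by
  have h := LJ_pow β h0 h1 0 t ht
  have g1 : Real.Gamma (2 - β) ≠ 0 := (Real.Gamma_pos_of_pos (by linarith)).ne'
  simp only [pow_zero] at h
  rw [h]
  congr 1
  simp [Real.Gamma_two, g1]

lemma LJ_id (β : ℝ) (h0 : 0 < β) (h1 : β ≤ 1) (t : ℝ) (ht : 0 < t) :
    LJ β (fun s => (s : ℂ)) t = ((t ^ 2 * ((2 - β) / 2) : ℝ) : ℂ) := by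
  have h := LJ_pow β h0 h1 1 t ht
  have g1 : Real.Gamma (2 - β) ≠ 0 := (Real.Gamma_pos_of_pos (by linarith)).ne'
  simp only [pow_one] at h
  rw [h]
  congr 1
  have a1 : Real.Gamma (((1 : ℕ) : ℝ) + 2 - β) = (2 - β) * Real.Gamma (2 - β) := by
    rw [← Real.Gamma_add_one (by linarith)]
    congr 1
    push_cast
    ring
  have a2 : Real.Gamma (((1 : ℕ) : ℝ) + 2) = 2 := by
    have : (((1 : ℕ) : ℝ) + 2) = 2 + 1 := by norm_num
    rw [this, Real.Gamma_add_one (by norm_num), Real.Gamma_two]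
    norm_num
  rw [a1, a2]
  field_simp
  ring

/-- For `0 < α ≤ 1/2`, the operators `ᴸJ^α ∘ ᴸJ^α` and `ᴸJ^(2α)` do not coincide on
continuous functions on `[0,T]`. -/
theorem LJ_comp_ne_LJ_two_mul
    (α T : ℝ) (hα0 : 0 < α) (hα2 : α ≤ 1 / 2) (hT : 0 < T) :
    ∃ y : ℝ → ℂ, ContinuousOn y (Set.Icc 0 T) ∧
      ∃ t ∈ Set.Icc (0:ℝ) T, LJ α (fun s => LJ α y s) t ≠ LJ (2 * α) y t := by
  have ht : 0 < min T 1 := lt_min hT one_pos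
  have ht1 : min T 1 ≤ 1 := min_le_right _ _
  refine ⟨fun _ => 1, continuousOn_const, min T 1, ⟨ht.le, min_le_left _ _⟩, ?_⟩
  generalize min T 1 = t at ht ht1
  have e : LJ α (fun s => LJ α (fun _ => 1) s) t = LJ α (fun s => (s : ℂ)) t := by
    conv_lhs => unfold LJ
    conv_rhs => unfold LJ
    congr 1
    apply intervalIntegral.integral_congr_ae
    refine Filter.Eventually.of_forall fun s hs => ?_
    rw [Set.uIoc_of_le ht.le] at hs
    have := LJ_one α hα0 (by linarith) s hs.1
    unfold LJ at this
    simp only [this]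
  rw [e, LJ_id α hα0 (by linarith) t ht, LJ_one (2 * α) (by linarith) (by linarith) t ht]
  intro h
  have h' := Complex.ofReal_injective h
  have : t * ((2 - α) / 2) < 1 := by nlinarith
  nlinarith
end

section
/- Let 0 < α < 1, T > 0, d ≥ 1, and let y : [0,T] → ℂᵈ be continuous. Define (ᴸJ^α y)(t) = (1/(Γ(α)Γ(2−α))) ∫₀ᵗ (t−s)^{α−1} s^{1−α} y(s) ds (componentwise, with (ᴸJ^α y)(0) = 0). Then (i) ᴸJ^α y is continuous on [0,T]; and (ii) for every t ∈ [0,T], ‖(ᴸJ^α y)(t)‖ ≤ t · sup_{s∈[0,T]} ‖y(s)‖, where ‖·‖ is the Euclidean norm on ℂᵈ. In particular ᴸJ^α, as a linear operator on the space of continuous functions [0,T] → ℂᵈ with the supremum norm, is continuous with operator norm at most T. -/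
open MeasureTheory Set


lemma kernel_integrable (α : ℝ) (hα0 : 0 < α) (hα1 : α < 1) :
    IntervalIntegrable (fun u : ℝ => (1 - u) ^ (α - 1) * u ^ (1 - α)) volume 0 1 := by
  have h1 : IntervalIntegrable (fun x : ℝ => x ^ (α - 1)) volume 1 0 :=
    intervalIntegral.intervalIntegrable_rpow' (by linarith)
  have h2 := h1.comp_sub_left 1
  rw [sub_self, sub_zero] at h2
  apply h2.mul_continuousOn
  exact (Real.continuous_rpow_const (by linarith)).continuousOn

lemma kernel_integral (α : ℝ) (hα0 : 0 < α) (hα1 : α < 1) :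
    ∫ u in (0:ℝ)..1, (1 - u) ^ (α - 1) * u ^ (1 - α)
      = Real.Gamma α * Real.Gamma (2 - α) := by
  have h := Complex.betaIntegral_eq_Gamma_mul_div ((2 - α : ℝ) : ℂ) (α : ℂ)
    (by rw [Complex.ofReal_re]; linarith) (by rw [Complex.ofReal_re]; linarith)
  have h2 : ((2 - α : ℝ) : ℂ) + (α : ℂ) = 1 + 1 := by push_cast; ring
  rw [h2, Complex.Gamma_add_one 1 one_ne_zero, Complex.Gamma_one, Complex.Gamma_ofReal,
    Complex.Gamma_ofReal, Complex.betaIntegral] at h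
  have h3 : ∫ x : ℝ in (0:ℝ)..1, (x : ℂ) ^ (((2 - α : ℝ) : ℂ) - 1) * (1 - (x : ℂ)) ^ ((α : ℂ) - 1)
      = ∫ x : ℝ in (0:ℝ)..1, (((1 - x) ^ (α - 1) * x ^ (1 - α) : ℝ) : ℂ) := by
    apply intervalIntegral.integral_congr
    intro x hx
    rw [uIcc_of_le zero_le_one] at hx
    simp only
    rw [Complex.ofReal_mul, Complex.ofReal_cpow (by linarith [hx.2]), Complex.ofReal_cpow hx.1,
      mul_comm]
    push_cast
    congr 2
    ring
  rw [h3, intervalIntegral.integral_ofReal] at h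
  have h4 : ((Real.Gamma (2 - α) : ℂ) * (Real.Gamma α : ℂ)) / (1 * 1)
      = ((Real.Gamma α * Real.Gamma (2 - α) : ℝ) : ℂ) := by
    push_cast; ring
  rw [h4] at h
  exact_mod_cast h

lemma kernel_subst {E : Type*} [NormedAddCommGroup E] [NormedSpace ℝ E]
    (α T t : ℝ) (ht : t ∈ Icc 0 T) (y Y : ℝ → E)
    (hY : ∀ s ∈ Icc 0 T, Y s = y s) :
    ∫ s in (0:ℝ)..t, ((t - s) ^ (α - 1) * s ^ (1 - α)) • y s
      = t • ∫ u in (0:ℝ)..1, ((1 - u) ^ (α - 1) * u ^ (1 - α)) • Y (t * u) := by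
  have h := intervalIntegral.smul_integral_comp_mul_left (a := 0) (b := 1)
    (f := fun s : ℝ => ((t - s) ^ (α - 1) * s ^ (1 - α)) • y s) t
  rw [mul_zero, mul_one] at h
  rw [← h]
  rcases ht.1.eq_or_lt with h0 | h0
  · simp [← h0]
  congr 1
  apply intervalIntegral.integral_congr
  intro u hu
  rw [uIcc_of_le zero_le_one] at hu
  have hm : t * u ∈ Icc 0 T :=
    ⟨mul_nonneg h0.le hu.1, (mul_le_of_le_one_right h0.le hu.2).trans ht.2⟩
  simp only
  rw [hY _ hm]
  congr 1
  have e : t - t * u = t * (1 - u) := by ring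
  rw [e, Real.mul_rpow h0.le (by linarith [hu.2]), Real.mul_rpow h0.le hu.1]
  have e2 : t ^ (α - 1) * t ^ (1 - α) = 1 := by
    rw [← Real.rpow_add h0]; simp
  linear_combination ((1 - u) ^ (α - 1) * u ^ (1 - α)) * e2

/-- The L-fractional integral of a continuous function `y : [0,T] → ℂᵈ` is continuous on
`[0,T]`, and its norm at `t` is bounded by `t` times the supremum norm of `y`; in particular
the L-fractional integral operator has norm at most `T` on continuous functions. -/
theorem LJ_continuousOn_and_norm_bound
    (α T : ℝ) (d : ℕ) (hd : 1 ≤ d) (hα0 : 0 < α) (hα1 : α < 1) (hT : 0 < T)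
    (y : ℝ → EuclideanSpace ℂ (Fin d)) (hy : ContinuousOn y (Icc 0 T)) :
    ContinuousOn
      (fun t : ℝ => (1 / (Real.Gamma α * Real.Gamma (2 - α))) •
        ∫ s in (0:ℝ)..t, ((t - s) ^ (α - 1) * s ^ (1 - α)) • y s) (Icc 0 T) ∧
    ∀ t ∈ Icc (0:ℝ) T,
      ‖(1 / (Real.Gamma α * Real.Gamma (2 - α))) •
          ∫ s in (0:ℝ)..t, ((t - s) ^ (α - 1) * s ^ (1 - α)) • y s‖
        ≤ t * ⨆ s : Icc (0:ℝ) T, ‖y (s : ℝ)‖ := by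
  obtain ⟨M, hM⟩ : ∃ M, M = ⨆ s : Icc (0:ℝ) T, ‖y (s : ℝ)‖ := ⟨_, rfl⟩
  rw [← hM]
  have hbdd : BddAbove (range fun s : Icc (0:ℝ) T => ‖y (s : ℝ)‖) :=
    (isCompact_range (continuousOn_iff_continuous_domRestrict.1 hy).norm).bddAbove
  obtain ⟨Y, hYdef⟩ : ∃ Y, Y = IccExtend hT.le ((Icc 0 T).domRestrict y) := ⟨_, rfl⟩
  have hYc : Continuous Y := by
    rw [hYdef]
    exact (continuousOn_iff_continuous_domRestrict.1 hy).Icc_extend'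
  have hY : ∀ s ∈ Icc 0 T, Y s = y s := by
    intro s hs
    rw [hYdef, IccExtend_of_mem _ _ hs]
    rfl
  have hYM : ∀ s, ‖Y s‖ ≤ M := by
    intro s
    rw [hYdef, hM]
    exact le_ciSup hbdd (projIcc 0 T hT.le s)
  have hk := kernel_integrable α hα0 hα1
  have hkM := hk.mul_const M
  have hbound : ∀ t : ℝ, ∀ u ∈ Ioc (0:ℝ) 1,
      ‖((1 - u) ^ (α - 1) * u ^ (1 - α)) • Y (t * u)‖
        ≤ ((1 - u) ^ (α - 1) * u ^ (1 - α)) * M := by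
    intro t u hu
    have h0 : 0 ≤ (1 - u) ^ (α - 1) * u ^ (1 - α) :=
      mul_nonneg (Real.rpow_nonneg (by linarith [hu.2]) _) (Real.rpow_nonneg hu.1.le _)
    rw [norm_smul, Real.norm_of_nonneg h0]
    exact mul_le_mul_of_nonneg_left (hYM _) h0
  constructor
  · have hc : Continuous fun t : ℝ =>
        ∫ u in (0:ℝ)..1, ((1 - u) ^ (α - 1) * u ^ (1 - α)) • Y (t * u) := by
      apply intervalIntegral.continuous_of_dominated_interval
        (bound := fun u => ((1 - u) ^ (α - 1) * u ^ (1 - α)) * M)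
      · intro t
        rw [uIoc_of_le zero_le_one]
        have hc1 : Continuous fun u : ℝ => Y (t * u) := by fun_prop
        exact hk.1.aestronglyMeasurable.smul hc1.aestronglyMeasurable
      · intro t
        refine Filter.Eventually.of_forall fun u hu => ?_
        rw [uIoc_of_le zero_le_one] at hu
        exact hbound t u hu
      · exact hkM
      · refine Filter.Eventually.of_forall fun u _ => ?_
        fun_prop
    have hc2 : Continuous fun t : ℝ => (1 / (Real.Gamma α * Real.Gamma (2 - α))) •
        (t • ∫ u in (0:ℝ)..1, ((1 - u) ^ (α - 1) * u ^ (1 - α)) • Y (t * u)) := by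
      fun_prop
    refine hc2.continuousOn.congr fun t ht => ?_
    simp only
    rw [kernel_subst α T t ht y Y hY]
  · intro t ht
    rw [kernel_subst α T t ht y Y hY]
    have hG : 0 < Real.Gamma α * Real.Gamma (2 - α) :=
      mul_pos (Real.Gamma_pos_of_pos hα0) (Real.Gamma_pos_of_pos (by linarith))
    have hn := intervalIntegral.norm_integral_le_of_norm_le (μ := volume) zero_le_one
      (Filter.Eventually.of_forall (hbound t)) hkM
    rw [intervalIntegral.integral_mul_const, kernel_integral α hα0 hα1] at hn
    rw [norm_smul, norm_smul, Real.norm_of_nonneg ht.1, Real.norm_of_nonneg (by positivity)]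
    calc _ ≤ 1 / (Real.Gamma α * Real.Gamma (2 - α)) *
          (t * (Real.Gamma α * Real.Gamma (2 - α) * M)) := by
            have := ht.1
            gcongr
      _ = t * M := by
            have := hG.ne'
            rw [one_div, mul_left_comm t, inv_mul_cancel_left₀ this]
end

section
/- Let 0 < α < 1, T > 0, d ≥ 1, x₀ ∈ ℂᵈ, and let f : [0,T] × ℂᵈ → ℂᵈ be continuous and Lipschitz-continuous in the second variable on compact sets (for every R > 0 there is M > 0 with ‖f(t,u) − f(t,v)‖ ≤ M ‖u − v‖ whenever t ∈ [0,T], ‖u‖ ≤ R, ‖v‖ ≤ R). If x₁, x₂ : [0,T] → ℂᵈ are continuous functions both satisfying the Volterra fixed-point equation xᵢ(t) = x₀ + (1/(Γ(α)Γ(2−α))) ∫₀ᵗ (t−s)^{α−1} s^{1−α} f(s, xᵢ(s)) ds for every t ∈ [0,T], then x₁ = x₂ on [0,T]. -/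
open MeasureTheory Set

lemma exp_kernel_bound (α lam t : ℝ) (hα : 0 < α) (hl : 0 < lam) (ht : 0 ≤ t) :
    ∫ s in (0:ℝ)..t, (t - s) ^ (α - 1) * Real.exp (lam * s) ≤
      Real.exp (lam * t) * ((1 / lam) ^ α * Real.Gamma α) := by
  have e1 : ∫ s in (0:ℝ)..t, (t - s) ^ (α - 1) * Real.exp (lam * s) =
      ∫ r in (0:ℝ)..t, Real.exp (lam * t) * (r ^ (α - 1) * Real.exp (-(lam * r))) := by
    have := intervalIntegral.integral_comp_sub_left (a := 0) (b := t)
      (fun r => Real.exp (lam * t) * (r ^ (α - 1) * Real.exp (-(lam * r)))) t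
    rw [sub_self, sub_zero] at this
    rw [← this]
    congr 1
    ext s
    rw [mul_left_comm, ← Real.exp_add]
    congr 2
    ring
  have hv := Real.integral_rpow_mul_exp_neg_mul_Ioi hα hl
  have hint : IntegrableOn (fun r : ℝ => r ^ (α - 1) * Real.exp (-(lam * r))) (Ioi 0) := by
    by_contra h
    rw [integral_undef h] at hv
    have h1 : 0 < (1 / lam) ^ α * Real.Gamma α :=
      mul_pos (Real.rpow_pos_of_pos (by positivity) _) (Real.Gamma_pos_of_pos hα)
    linarith
  rw [e1, intervalIntegral.integral_const_mul, ← hv]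
  refine mul_le_mul_of_nonneg_left ?_ (Real.exp_pos _).le
  rw [intervalIntegral.integral_of_le ht]
  refine setIntegral_mono_set hint ?_ (Ioc_subset_Ioi_self.eventuallyLE)
  refine (ae_restrict_iff' measurableSet_Ioi).2 (ae_of_all _ fun r hr => ?_)
  exact mul_nonneg (Real.rpow_nonneg (le_of_lt hr) _) (Real.exp_pos _).le

lemma kernel_intervalIntegrable (α t : ℝ) (hα : 0 < α) :
    IntervalIntegrable (fun s : ℝ => (t - s) ^ (α - 1)) volume 0 t := by
  have h := (intervalIntegral.intervalIntegrable_rpow' (a := 0) (b := t)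
    (r := α - 1) (by linarith)).comp_sub_left t
  rw [sub_zero, sub_self] at h
  exact h.symm

/-- Uniqueness for the Volterra fixed-point formulation of the L-fractional initial value
problem `ᴸD^α x = f(t,x)`, `x(0) = x₀`, when `f` is continuous and Lipschitz in its second
variable on compact sets. -/
theorem L_fractional_uniqueness
    (α T : ℝ) (d : ℕ) (hd : 1 ≤ d) (hα0 : 0 < α) (hα1 : α < 1) (hT : 0 < T)
    (x₀ : EuclideanSpace ℂ (Fin d))
    (f : ℝ → EuclideanSpace ℂ (Fin d) → EuclideanSpace ℂ (Fin d))
    (hfc : ContinuousOn (fun p : ℝ × EuclideanSpace ℂ (Fin d) => f p.1 p.2)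
      (Icc 0 T ×ˢ (univ : Set (EuclideanSpace ℂ (Fin d)))))
    (hlip : ∀ R : ℝ, 0 < R → ∃ M : ℝ, 0 < M ∧
      ∀ t ∈ Icc (0:ℝ) T, ∀ u v : EuclideanSpace ℂ (Fin d),
        ‖u‖ ≤ R → ‖v‖ ≤ R → ‖f t u - f t v‖ ≤ M * ‖u - v‖)
    (x₁ x₂ : ℝ → EuclideanSpace ℂ (Fin d))
    (h1c : ContinuousOn x₁ (Icc 0 T)) (h2c : ContinuousOn x₂ (Icc 0 T))
    (h1 : ∀ t ∈ Icc (0:ℝ) T,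
      x₁ t = x₀ + (1 / (Real.Gamma α * Real.Gamma (2 - α))) •
        ∫ s in (0:ℝ)..t, ((t - s) ^ (α - 1) * s ^ (1 - α)) • f s (x₁ s))
    (h2 : ∀ t ∈ Icc (0:ℝ) T,
      x₂ t = x₀ + (1 / (Real.Gamma α * Real.Gamma (2 - α))) •
        ∫ s in (0:ℝ)..t, ((t - s) ^ (α - 1) * s ^ (1 - α)) • f s (x₂ s)) :
    ∀ t ∈ Icc (0:ℝ) T, x₁ t = x₂ t := by
  have hcont : ∀ x : ℝ → EuclideanSpace ℂ (Fin d), ContinuousOn x (Icc 0 T) →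
      ContinuousOn (fun s => f s (x s)) (Icc 0 T) := fun x hx =>
    hfc.comp (f := fun s => (s, x s)) (continuousOn_id.prodMk hx) (fun s hs => ⟨hs, mem_univ _⟩)
  have hII : ∀ x : ℝ → EuclideanSpace ℂ (Fin d), ContinuousOn x (Icc 0 T) →
      ∀ t ∈ Icc (0:ℝ) T, IntervalIntegrable
        (fun s => ((t - s) ^ (α - 1) * s ^ (1 - α)) • f s (x s)) volume 0 t := by
    intro x hx t ht
    have hk : IntervalIntegrable (fun s : ℝ => (t - s) ^ (α - 1) * s ^ (1 - α)) volume 0 t :=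
      (kernel_intervalIntegrable α t hα0).mul_continuousOn
        (continuousOn_id.rpow_const (fun s _ => Or.inr (by linarith)))
    refine hk.smul_continuousOn ?_
    rw [uIcc_of_le ht.1]
    exact (hcont x hx).mono (Icc_subset_Icc_right ht.2)
  obtain ⟨R1, hR1⟩ := isCompact_Icc.exists_bound_of_continuousOn h1c
  obtain ⟨R2, hR2⟩ := isCompact_Icc.exists_bound_of_continuousOn h2c
  obtain ⟨M, hM, hL⟩ := hlip (max 1 (max R1 R2)) (by positivity)
  set c : ℝ := 1 / (Real.Gamma α * Real.Gamma (2 - α)) with hc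
  have hG : 0 < Real.Gamma α := Real.Gamma_pos_of_pos hα0
  have hc0 : 0 < c := by
    have := Real.Gamma_pos_of_pos (s := 2 - α) (by linarith)
    positivity
  set K : ℝ := c * (T ^ (1 - α) * M) with hK
  have hT' : 0 < T ^ (1 - α) := Real.rpow_pos_of_pos hT _
  have hK0 : 0 < K := by positivity
  set B : ℝ := K * Real.Gamma α + 1 with hB
  have hB0 : 0 < B := by positivity
  set lam : ℝ := B ^ (1 / α) with hlam
  have hl0 : 0 < lam := Real.rpow_pos_of_pos hB0 _
  have hlB : (1 / lam) ^ α = 1 / B := by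
    rw [Real.div_rpow zero_le_one hl0.le, Real.one_rpow, hlam, ← Real.rpow_mul hB0.le,
      one_div_mul_cancel hα0.ne', Real.rpow_one]
  obtain ⟨t0, ht0, hmax⟩ := isCompact_Icc.exists_isMaxOn (nonempty_Icc.2 hT.le)
    (f := fun t => Real.exp (-(lam * t)) * ‖x₁ t - x₂ t‖)
    (ContinuousOn.mul (by fun_prop) (h1c.sub h2c).norm)
  set m : ℝ := Real.exp (-(lam * t0)) * ‖x₁ t0 - x₂ t0‖ with hm
  have hm0 : 0 ≤ m := by positivity
  have hle : ∀ s ∈ Icc (0:ℝ) T, ‖x₁ s - x₂ s‖ ≤ m * Real.exp (lam * s) := by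
    intro s hs
    have h : Real.exp (-(lam * s)) * ‖x₁ s - x₂ s‖ ≤ m := hmax hs
    calc ‖x₁ s - x₂ s‖ = (Real.exp (-(lam * s)) * ‖x₁ s - x₂ s‖) * Real.exp (lam * s) := by
          rw [mul_right_comm, ← Real.exp_add]; simp
      _ ≤ _ := mul_le_mul_of_nonneg_right h (Real.exp_pos _).le
  have hkey : ‖x₁ t0 - x₂ t0‖ ≤ K * m * (Real.exp (lam * t0) * (1 / B * Real.Gamma α)) := by
    have hd' : x₁ t0 - x₂ t0 = c • ∫ s in (0:ℝ)..t0,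
        (((t0 - s) ^ (α - 1) * s ^ (1 - α)) • f s (x₁ s) -
          ((t0 - s) ^ (α - 1) * s ^ (1 - α)) • f s (x₂ s)) := by
      rw [intervalIntegral.integral_sub (hII x₁ h1c t0 ht0) (hII x₂ h2c t0 ht0), smul_sub,
        h1 t0 ht0, h2 t0 ht0]
      abel
    have hb : ‖∫ s in (0:ℝ)..t0,
        (((t0 - s) ^ (α - 1) * s ^ (1 - α)) • f s (x₁ s) -
          ((t0 - s) ^ (α - 1) * s ^ (1 - α)) • f s (x₂ s))‖ ≤
        ∫ s in (0:ℝ)..t0, (T ^ (1 - α) * M * m) * ((t0 - s) ^ (α - 1) * Real.exp (lam * s)) := by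
      refine intervalIntegral.norm_integral_le_of_norm_le ht0.1 (ae_of_all _ ?_) ?_
      · intro s hs
        have hsT : s ∈ Icc (0:ℝ) T := ⟨hs.1.le, hs.2.trans ht0.2⟩
        have hA : 0 ≤ (t0 - s) ^ (α - 1) := Real.rpow_nonneg (sub_nonneg.2 hs.2) _
        have hS : 0 ≤ s ^ (1 - α) := Real.rpow_nonneg hs.1.le _
        have hST : s ^ (1 - α) ≤ T ^ (1 - α) :=
          Real.rpow_le_rpow hs.1.le hsT.2 (by linarith)
        have hf := hL s hsT (x₁ s) (x₂ s)
          ((hR1 s hsT).trans ((le_max_left _ _).trans (le_max_right _ _)))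
          ((hR2 s hsT).trans ((le_max_right _ _).trans (le_max_right _ _)))
        have hf2 : ‖f s (x₁ s) - f s (x₂ s)‖ ≤ M * (m * Real.exp (lam * s)) :=
          hf.trans (mul_le_mul_of_nonneg_left (hle s hsT) hM.le)
        rw [← smul_sub, norm_smul, Real.norm_of_nonneg (mul_nonneg hA hS)]
        calc (t0 - s) ^ (α - 1) * s ^ (1 - α) * ‖f s (x₁ s) - f s (x₂ s)‖
            ≤ (t0 - s) ^ (α - 1) * T ^ (1 - α) * (M * (m * Real.exp (lam * s))) := by
              gcongr
          _ = _ := by ring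
      · exact ((kernel_intervalIntegrable α t0 hα0).mul_continuousOn (by fun_prop)).const_mul _
    rw [intervalIntegral.integral_const_mul] at hb
    have he := exp_kernel_bound α lam t0 hα0 hl0 ht0.1
    rw [hlB] at he
    rw [hd', norm_smul, Real.norm_of_nonneg hc0.le]
    calc _ ≤ c * ((T ^ (1 - α) * M * m) * (Real.exp (lam * t0) * (1 / B * Real.Gamma α))) :=
          mul_le_mul_of_nonneg_left
            (hb.trans (mul_le_mul_of_nonneg_left he (by positivity))) hc0.le
      _ = _ := by rw [hK]; ring
  have hmm : m ≤ m * (K * Real.Gamma α / B) := by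
    calc m ≤ Real.exp (-(lam * t0)) *
          (K * m * (Real.exp (lam * t0) * (1 / B * Real.Gamma α))) :=
          mul_le_mul_of_nonneg_left hkey (Real.exp_pos _).le
      _ = (Real.exp (-(lam * t0)) * Real.exp (lam * t0)) * (m * (K * Real.Gamma α / B)) := by
          ring
      _ = _ := by rw [← Real.exp_add]; simp
  have hlt : K * Real.Gamma α / B < 1 := by
    rw [div_lt_one hB0]; linarith
  have hmz : m = 0 := by nlinarith
  intro t ht
  have h := hle t ht
  rw [hmz, zero_mul] at h
  exact sub_eq_zero.1 (norm_le_zero_iff.1 h)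
end
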